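/- Let T be an ABC-tile having exactly 14 neighbors. Then for any three pairwise distinct α, β, γ ∈ ℤ³ \ {0}, the 4-fold intersection T ∩ (T + α) ∩ (T + β) ∩ (T + γ) is either a single point or empty. Moreover, there are exactly 24 three-element subsets {α, β, γ} of ℤ³ \ {0} for which this intersection is nonempty. -/

import Mathlib

open MeasureTheory

noncomputable def Mmat (A B C : ℤ) : Matrix (Fin 3) (Fin 3) ℝ :=
  !![0, 0, -(C : ℝ); 1, 0, -(B : ℝ); 0, 1, -(A : ℝ)]

def Ddig (C : ℤ) : Set (Fin 3 → ℝ) :=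
  {d | ∃ i : ℤ, 0 ≤ i ∧ i < C ∧ d = ![(i : ℝ), 0, 0]}

def toR (α : Fin 3 → ℤ) : Fin 3 → ℝ := fun i => (α i : ℝ)

def tileTranslate (v : Fin 3 → ℝ) (T : Set (Fin 3 → ℝ)) : Set (Fin 3 → ℝ) :=
  (fun x => x + v) '' T

def IsABCTile (A B C : ℤ) (T : Set (Fin 3 → ℝ)) : Prop :=
  1 ≤ A ∧ A ≤ B ∧ B < C ∧
  T.Nonempty ∧ IsCompact T ∧ 0 < volume T ∧
  (Mmat A B C).mulVec '' T = ⋃ d ∈ Ddig C, tileTranslate d T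

def Neighbors (T : Set (Fin 3 → ℝ)) : Set (Fin 3 → ℤ) :=
  {α | α ≠ 0 ∧ (T ∩ tileTranslate (toR α) T).Nonempty}

def wz : Fin 4 → ℤ × ℤ × ℤ := ![(1,0,0),(-1,1,0),(0,-1,1),(0,0,-1)]
def pz (τ : Equiv.Perm (Fin 4)) : Fin 4 → ℤ × ℤ × ℤ :=
  ![0, wz (τ 0), wz (τ 0) + wz (τ 1), wz (τ 0) + wz (τ 1) + wz (τ 2)]
def S0 : Finset (ℤ × ℤ × ℤ) :=
  {(1,0,0),(0,1,0),(0,0,1),(-1,1,0),(0,-1,1),(-1,0,1),(1,-1,1),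
   (-1,0,0),(0,-1,0),(0,0,-1),(1,-1,0),(0,1,-1),(1,0,-1),(-1,1,-1)}
def F0 : Finset (Finset (ℤ × ℤ × ℤ)) :=
  Finset.univ.image fun τ : Equiv.Perm (Fin 4) => {pz τ 1, pz τ 2, pz τ 3}
theorem F0_card : F0.card = 24 := by decide +kernel
theorem S0_card : S0.card = 14 := by decide +kernel
theorem S0_mem : ∀ s ∈ S0, ∃ τ : Equiv.Perm (Fin 4), s = pz τ 1 ∨ s = pz τ 2 ∨ s = pz τ 3 := by
  decide +kernel
theorem S0_ne : ∀ s ∈ S0, s ≠ 0 := by decide +kernel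
theorem pz_ne : ∀ τ : Equiv.Perm (Fin 4), pz τ 1 ≠ 0 ∧ pz τ 2 ≠ 0 ∧ pz τ 3 ≠ 0 ∧
   pz τ 1 ≠ pz τ 2 ∧ pz τ 1 ≠ pz τ 3 ∧ pz τ 2 ≠ pz τ 3 := by decide +kernel
theorem classify : ∀ a ∈ S0, ∀ b ∈ S0, a - b ∉ S0 ∨ ∀ c ∈ S0, a - c ∉ S0 ∨ b - c ∉ S0 ∨
   ({a,b,c} : Finset (ℤ × ℤ × ℤ)) ∈ F0 := by decide +kernel

theorem kakeya (A B C : ℝ) (hA : 1 ≤ A) (hAB : A ≤ B) (hBC : B < C) (z : ℂ)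
    (hz : C * z^3 + B * z^2 + A * z + 1 = 0) : ‖z‖ < 1 := by
  by_contra hcon
  push Not at hcon
  set r := ‖z‖ with hr
  have hz0 : z ≠ 0 := by
    intro h; rw [h] at hr; simp at hr; linarith
  -- z^4 C - 1 ... divide by z^3
  have e1 : (C : ℂ) * z^4 - ((C:ℂ) - B) * z^3 = ((B:ℂ) - A) * z^2 + ((A:ℂ) - 1) * z + 1 := by
    linear_combination (z - 1) * hz
  have e2 : ‖(C : ℂ) * z - ((C:ℂ) - B)‖ * r^3 ≤ (C - (C - B)) * r^3 := by
    have : ‖(C : ℂ) * z^4 - ((C:ℂ) - B) * z^3‖ ≤ (B - A) * r^2 + (A - 1) * r + 1 := by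
      rw [e1]
      have h1 : ‖((B:ℂ) - A)‖ = B - A := by
        rw [← Complex.ofReal_sub, Complex.norm_real, Real.norm_of_nonneg (by linarith)]
      have h2 : ‖((A:ℂ) - 1)‖ = A - 1 := by
        rw [← Complex.ofReal_one, ← Complex.ofReal_sub, Complex.norm_real,
          Real.norm_of_nonneg (by linarith)]
      calc _ ≤ ‖((B:ℂ) - A) * z^2‖ + ‖((A:ℂ) - 1) * z‖ + ‖(1:ℂ)‖ := norm_add₃_le
        _ = _ := by rw [norm_mul, norm_mul, norm_pow, h1, h2, norm_one]
    have h3 : ‖(C : ℂ) * z^4 - ((C:ℂ) - B) * z^3‖ = ‖(C : ℂ) * z - ((C:ℂ) - B)‖ * r^3 := by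
      rw [hr, ← norm_pow, ← norm_mul]; congr 1; ring
    rw [h3] at this
    refine this.trans ?_
    have a1 : r ≤ r^3 := le_self_pow₀ hcon (by norm_num)
    have a2 : r^2 ≤ r^3 := pow_le_pow_right₀ hcon (by norm_num)
    have a3 : 1 ≤ r^3 := one_le_pow₀ hcon
    nlinarith [mul_le_mul_of_nonneg_left a1 (sub_nonneg.2 hA),
      mul_le_mul_of_nonneg_left a2 (sub_nonneg.2 hAB)]
  have e3 : ‖(C : ℂ) * z - ((C:ℂ) - B)‖ ≤ B := by
    have : 0 < r^3 := by positivity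
    have := le_of_mul_le_mul_right e2 this
    linarith
  -- real part is at least 1, so z = 1
  have e4 : ‖(C : ℂ) * z - ((C:ℂ) - B)‖^2 = (C * z.re - (C - B))^2 + (C * z.im)^2 := by
    rw [Complex.sq_norm, Complex.normSq_apply]; simp; ring
  have e5 : z.re^2 + z.im^2 = r^2 := by
    rw [hr, Complex.sq_norm, Complex.normSq_apply]; ring
  have e6 : 1 ≤ r^2 := one_le_pow₀ hcon
  have e7 : (C * z.re - (C - B))^2 + (C * z.im)^2 ≤ B^2 := by
    rw [← e4]; exact pow_le_pow_left₀ (norm_nonneg _) e3 2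
  have e8 : 1 ≤ z.re := by
    by_contra h
    push Not at h
    nlinarith [mul_pos (show 0 < C by linarith) (show 0 < C - B by linarith),
      mul_pos (mul_pos (show 0 < C by linarith) (show 0 < C - B by linarith)) (sub_pos.2 h),
      mul_nonneg (sq_nonneg C) (sub_nonneg.2 e6)]
  have e9 : z.re = 1 ∧ z.im = 0 := by
    have hC : 0 < C := by linarith
    have k : C * z.re - (C - B) ≤ B := by
      nlinarith [sq_nonneg (C * z.im)]
    have k1 : z.re ≤ 1 := by nlinarith
    have k2 : z.re = 1 := le_antisymm k1 e8
    rw [k2] at e7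
    have : (C * z.im)^2 ≤ 0 := by nlinarith
    have h0 : C * z.im = 0 := by nlinarith [sq_nonneg (C * z.im)]
    exact ⟨k2, (mul_eq_zero.1 h0).resolve_left hC.ne'⟩
  have : z = 1 := Complex.ext (by simp [e9.1]) (by simp [e9.2])
  rw [this] at hz
  have : ((C + B + A + 1 : ℝ) : ℂ) = 0 := by push_cast; linear_combination hz
  have := Complex.ofReal_eq_zero.1 this
  linarith

noncomputable def Nmat (A B C : ℤ) : Matrix (Fin 3) (Fin 3) ℂ :=
  !![-(B:ℂ)/C, 1, 0; -(A:ℂ)/C, 0, 1; -1/(C:ℂ), 0, 0]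

section
attribute [local instance] Matrix.linftyOpNormedRing Matrix.linftyOpNormedAlgebra
  Matrix.linftyOpNormedAddCommGroup

theorem expand (A B C : ℤ) (hA : 1 ≤ A) (hAB : A ≤ B) (hBC : B < C) :
    ∃ n : ℕ, ∀ w : Fin 3 → ℝ, ‖w‖ ≤ (1/2) * ‖((Mmat A B C)^n).mulVec w‖ := by
  have hC0 : (C:ℂ) ≠ 0 := by exact_mod_cast (show C ≠ 0 by lia)
  have hsp : spectralRadius ℂ (Nmat A B C) < (1 : NNReal) := by
    apply spectrum.spectralRadius_lt_of_forall_lt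
    intro z hz
    rw [Matrix.mem_spectrum_iff_isRoot_charpoly, Polynomial.IsRoot, Matrix.eval_charpoly] at hz
    have : ((C:ℝ):ℂ) * z^3 + ((B:ℝ):ℂ) * z^2 + ((A:ℝ):ℂ) * z + 1 = 0 := by
      simp [Nmat, Matrix.det_fin_three] at hz
      field_simp at hz
      push_cast
      linear_combination hz
    exact kakeya A B C (by exact_mod_cast hA) (by exact_mod_cast hAB) (by exact_mod_cast hBC) z this
  have hn : ∃ n : ℕ, ‖(Nmat A B C)^n‖ ≤ 1/2 := by
    have ht := spectrum.pow_nnnorm_pow_one_div_tendsto_nhds_spectralRadius (Nmat A B C)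
    obtain ⟨r, hr1, hr2⟩ := ENNReal.lt_iff_exists_nnreal_btwn.1 hsp
    have hr2' : r < 1 := by exact_mod_cast hr2
    have h1 := ht.eventually_lt_const hr1
    have h2 : ∀ᶠ n : ℕ in Filter.atTop, r^n < (1/2 : NNReal) :=
      (tendsto_pow_atTop_nhds_zero_of_lt_one zero_le hr2').eventually_lt_const (by norm_num)
    obtain ⟨n, h1, h2, h3⟩ := (h1.and (h2.and (Filter.eventually_ge_atTop 1))).exists
    refine ⟨n, ?_⟩
    have hn0 : (n:ℝ) ≠ 0 := by positivity
    have := ENNReal.rpow_le_rpow h1.le (show (0:ℝ) ≤ n by positivity)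
    rw [← ENNReal.rpow_mul, one_div_mul_cancel hn0, ENNReal.rpow_one, ENNReal.rpow_natCast] at this
    have h4 : ‖(Nmat A B C)^n‖₊ ≤ r^n := by exact_mod_cast this
    have h5 := h4.trans h2.le
    exact_mod_cast h5
  obtain ⟨n, hn⟩ := hn
  refine ⟨n, fun w => ?_⟩
  have hinv : Nmat A B C * (Mmat A B C).map Complex.ofRealHom = 1 := by
    ext i j
    fin_cases i <;> fin_cases j <;> simp [Nmat, Mmat, Matrix.mul_apply, Fin.sum_univ_three] <;>
      field_simp <;> simp
  have hcomm := mul_eq_one_comm.1 hinv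
  have hpow : (Nmat A B C)^n * ((Mmat A B C).map Complex.ofRealHom)^n = 1 := by
    rw [← (show Commute _ _ from hinv.trans hcomm.symm).mul_pow, hinv, one_pow]
  have hnorm : ∀ u : Fin 3 → ℝ, ‖Complex.ofRealHom ∘ u‖ = ‖u‖ := by
    intro u
    simp [Pi.norm_def]
  have key : Complex.ofRealHom ∘ w =
      ((Nmat A B C)^n).mulVec (Complex.ofRealHom ∘ (((Mmat A B C)^n).mulVec w)) := by
    have : Complex.ofRealHom ∘ (((Mmat A B C)^n).mulVec w) =
        (((Mmat A B C).map Complex.ofRealHom)^n).mulVec (Complex.ofRealHom ∘ w) := by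
      rw [← Matrix.map_pow]
      ext i
      exact RingHom.map_mulVec _ _ _ _
    rw [this, Matrix.mulVec_mulVec, hpow, Matrix.one_mulVec]
  rw [← hnorm w, key]
  refine (Matrix.linfty_opNorm_mulVec _ _).trans ?_
  rw [hnorm]
  exact mul_le_mul_of_nonneg_right hn (norm_nonneg _)
end

/-! ### Main part -/

/-- lattice vector with coordinates in the basis `P, Q, N` -/
def Lz (A B : ℤ) (s : ℤ × ℤ × ℤ) : Fin 3 → ℤ :=
  ![s.1 + A * s.2.1 + B * s.2.2, s.2.1 + A * s.2.2, s.2.2]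

def Lr (A B : ℤ) (s : ℤ × ℤ × ℤ) : Fin 3 → ℝ := toR (Lz A B s)

def ev (i : ℤ) : Fin 3 → ℝ := ![(i : ℝ), 0, 0]

/-- digit increments -/
def cz (A B C : ℤ) : Fin 4 → ℤ := ![A - 1, B - A, C - B, 1 - C]

theorem toR_sub (a b : Fin 3 → ℤ) : toR (a - b) = toR a - toR b := by
  ext i; simp [toR]

theorem Lz_inj (A B : ℤ) : Function.Injective (Lz A B) := by
  rintro ⟨a, b, c⟩ ⟨a', b', c'⟩ h
  have h0 := congrFun h 0
  have h1 := congrFun h 1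
  have h2 := congrFun h 2
  simp [Lz] at h0 h1 h2
  subst h2
  have h1 : b = b' := by linarith
  subst h1
  have h0 : a = a' := by linarith
  subst h0
  rfl

theorem Lz_sub (A B : ℤ) (s t : ℤ × ℤ × ℤ) : Lz A B (s - t) = Lz A B s - Lz A B t := by
  ext i; fin_cases i <;> simp [Lz] <;> ring

theorem Lz_zero (A B : ℤ) : Lz A B 0 = 0 := by
  ext i; fin_cases i <;> simp [Lz]

theorem Lr_zero (A B : ℤ) : Lr A B 0 = 0 := by
  ext i; simp [Lr, Lz_zero, toR]

theorem Lr_add (A B : ℤ) (s t : ℤ × ℤ × ℤ) : Lr A B (s + t) = Lr A B s + Lr A B t := by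
  ext i; fin_cases i <;> simp [Lr, toR, Lz] <;> ring

theorem M_Lr (A B C a b c : ℤ) :
    (Mmat A B C).mulVec (Lr A B (a, b, c)) = Lr A B (-(a * A + b * B + c * C), a, b) := by
  ext i
  fin_cases i <;> simp [Lr, toR, Lz, Mmat, Matrix.mulVec, dotProduct, Fin.sum_univ_three] <;> ring

theorem Lr_ev (A B k a b i : ℤ) : Lr A B (k, a, b) + ev i = Lr A B (k + i, a, b) := by
  ext j; fin_cases j <;> simp [Lr, toR, Lz, ev] <;> ring

theorem ev_sub (i j : ℤ) : ev i - ev j = ev (i - j) := by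
  ext k; fin_cases k <;> simp [ev]

theorem ev_add (i j : ℤ) : ev i + ev j = ev (i + j) := by
  ext k; fin_cases k <;> simp [ev]

def nxt (τ : Equiv.Perm (Fin 4)) : Equiv.Perm (Fin 4) := τ.trans (Equiv.addRight 1)

theorem nxt_apply (τ : Equiv.Perm (Fin 4)) (j : Fin 4) : nxt τ j = τ j + 1 := rfl

theorem M_w (A B C : ℤ) (k : Fin 4) :
    (Mmat A B C).mulVec (Lr A B (wz k)) = Lr A B (wz (k + 1)) - ev (cz A B C k) := by
  rw [eq_sub_iff_add_eq]
  fin_cases k <;> simp [wz, M_Lr, Lr_ev, cz] <;> congr 2 <;> ring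

theorem pz_step (τ : Equiv.Perm (Fin 4)) : pz τ 0 = 0 ∧ pz τ 1 = pz τ 0 + wz (τ 0) ∧
    pz τ 2 = pz τ 1 + wz (τ 1) ∧ pz τ 3 = pz τ 2 + wz (τ 2) ∧ pz τ 0 = pz τ 3 + wz (τ 3) := by
  refine ⟨rfl, by simp [pz], by simp [pz], by simp [pz], ?_⟩
  have h : ∑ j, wz (τ j) = ∑ j, wz j := Equiv.sum_comp τ wz
  have h2 : ∑ j, wz j = 0 := by decide
  rw [h2, Fin.sum_univ_four] at h
  simpa [pz] using h.symm

theorem pz_succ (τ : Equiv.Perm (Fin 4)) (j : Fin 4) : pz τ (j + 1) = pz τ j + wz (τ j) := by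
  obtain ⟨_, h1, h2, h3, h4⟩ := pz_step τ
  fin_cases j
  · exact h1
  · exact h2
  · exact h3
  · exact h4

theorem cz_sum (A B C : ℤ) (τ : Equiv.Perm (Fin 4)) :
    cz A B C (τ 0) + cz A B C (τ 1) + cz A B C (τ 2) + cz A B C (τ 3) = 0 := by
  have h : ∑ j, cz A B C (τ j) = ∑ j, cz A B C j := Equiv.sum_comp τ _
  rw [Fin.sum_univ_four, Fin.sum_univ_four] at h
  rw [h]; simp [cz]

theorem cz_nonneg (A B C : ℤ) (hA : 1 ≤ A) (hAB : A ≤ B) (hBC : B < C) (k : Fin 4) (hk : k ≠ 3) :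
    0 ≤ cz A B C k := by
  fin_cases k <;> simp [cz] at * <;> lia

/-- `d` is an admissible digit vector for `τ` -/
def Dig (A B C : ℤ) (τ : Equiv.Perm (Fin 4)) (d : Fin 4 → ℤ) : Prop :=
  (∀ j, 0 ≤ d j ∧ d j < C) ∧ ∀ j, d (j + 1) - d j = cz A B C (τ j)

theorem dig_exists (A B C : ℤ) (hA : 1 ≤ A) (hAB : A ≤ B) (hBC : B < C)
    (τ : Equiv.Perm (Fin 4)) : ∃ d, Dig A B C τ d := by
  have hs := cz_sum A B C τ
  obtain ⟨t, ht⟩ := τ.surjective 3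
  have h3 : cz A B C (τ t) = 1 - C := by rw [ht]; rfl
  have hn : ∀ j, j ≠ t → 0 ≤ cz A B C (τ j) := fun j hj =>
    cz_nonneg A B C hA hAB hBC _ fun h => hj (τ.injective (h.trans ht.symm))
  have n0 := hn 0
  have n1 := hn 1
  have n2 := hn 2
  have n3 := hn 3
  clear hn ht
  set c0 := cz A B C (τ 0)
  set c1 := cz A B C (τ 1)
  set c2 := cz A B C (τ 2)
  set c3 := cz A B C (τ 3)
  have mk : ∀ d0 : ℤ, (0 ≤ d0 ∧ d0 < C) → (0 ≤ d0 + c0 ∧ d0 + c0 < C) →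
      (0 ≤ d0 + c0 + c1 ∧ d0 + c0 + c1 < C) →
      (0 ≤ d0 + c0 + c1 + c2 ∧ d0 + c0 + c1 + c2 < C) → ∃ d, Dig A B C τ d := by
    intro d0 a0 a1 a2 a3
    refine ⟨![d0, d0 + c0, d0 + c0 + c1, d0 + c0 + c1 + c2], fun j => ?_, fun j => ?_⟩
    · fin_cases j
      · exact a0
      · exact a1
      · exact a2
      · exact a3
    · fin_cases j
      · change d0 + c0 - d0 = c0; ring
      · change d0 + c0 + c1 - (d0 + c0) = c1; ring
      · change d0 + c0 + c1 + c2 - (d0 + c0 + c1) = c2; ring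
      · change d0 - (d0 + c0 + c1 + c2) = c3; linarith
  fin_cases t
  · have := n1 (by decide); have := n2 (by decide); have := n3 (by decide)
    change c0 = 1 - C at h3
    apply mk (C - 1) <;> constructor <;> linarith
  · have := n0 (by decide); have := n2 (by decide); have := n3 (by decide)
    change c1 = 1 - C at h3
    apply mk (C - 1 - c0) <;> constructor <;> linarith
  · have := n1 (by decide); have := n0 (by decide); have := n3 (by decide)
    change c2 = 1 - C at h3
    apply mk (c3) <;> constructor <;> linarith
  · have := n1 (by decide); have := n2 (by decide); have := n0 (by decide)
    change c3 = 1 - C at h3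
    apply mk 0 <;> constructor <;> linarith

theorem dig_unique (A B C : ℤ) (τ : Equiv.Perm (Fin 4)) (d d' : Fin 4 → ℤ)
    (h : Dig A B C τ d) (h' : Dig A B C τ d') : d 0 = d' 0 := by
  obtain ⟨t, ht⟩ := τ.surjective 3
  have h3 : cz A B C (τ t) = 1 - C := by rw [ht]; rfl
  have e := h.2 t
  have e' := h'.2 t
  have b1 := h.1 t
  have b2 := h.1 (t + 1)
  have b1' := h'.1 t
  have b2' := h'.1 (t + 1)
  have et : d t = d' t := by lia
  have s : ∀ j, d (j + 1) - d j = d' (j + 1) - d' j := fun j => (h.2 j).trans (h'.2 j).symm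
  have s0 : d 1 - d 0 = d' 1 - d' 0 := s 0
  have s1 : d 2 - d 1 = d' 2 - d' 1 := s 1
  have s2 : d 3 - d 2 = d' 3 - d' 2 := s 2
  clear e e' b1 b2 b1' b2' s ht h3
  fin_cases t <;> simp at et <;> lia

theorem M_p (A B C : ℤ) (τ : Equiv.Perm (Fin 4)) (d : Fin 4 → ℤ)
    (h : ∀ j, d (j + 1) - d j = cz A B C (τ j)) (j : Fin 4) :
    (Mmat A B C).mulVec (Lr A B (pz τ j)) = Lr A B (pz (nxt τ) j) + ev (d 0 - d j) := by
  have step : ∀ j, (Mmat A B C).mulVec (Lr A B (pz τ j)) =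
      Lr A B (pz (nxt τ) j) + ev (d 0 - d j) → 
      (Mmat A B C).mulVec (Lr A B (pz τ (j + 1))) =
      Lr A B (pz (nxt τ) (j + 1)) + ev (d 0 - d (j + 1)) := by
    intro j hj
    rw [pz_succ, pz_succ, Lr_add, Matrix.mulVec_add, hj, M_w, Lr_add, nxt_apply,
      show d 0 - d (j + 1) = (d 0 - d j) - cz A B C (τ j) by rw [← h j]; ring,
      ← ev_sub _ (cz A B C (τ j))]
    abel
  have z : (Mmat A B C).mulVec (Lr A B (pz τ 0)) =
      Lr A B (pz (nxt τ) 0) + ev (d 0 - d 0) := by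
    have : ev 0 = 0 := by ext k; fin_cases k <;> simp [ev]
    rw [(pz_step τ).1, (pz_step (nxt τ)).1, Lr_zero, Matrix.mulVec_zero, sub_self, this, add_zero]
  have o := step 0 z
  have tw := step 1 o
  have th := step 2 tw
  fin_cases j
  · exact z
  · exact o
  · exact tw
  · exact th

theorem mem_tr (v x : Fin 3 → ℝ) (T : Set (Fin 3 → ℝ)) : x ∈ tileTranslate v T ↔ x - v ∈ T := by
  constructor
  · rintro ⟨t, ht, rfl⟩; simpa using ht
  · intro h; exact ⟨x - v, h, by simp⟩

theorem tile_fw {A B C : ℤ} {T : Set (Fin 3 → ℝ)} (hT : IsABCTile A B C T) {x : Fin 3 → ℝ}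
    (hx : x ∈ T) : ∃ t ∈ T, ∃ i : ℤ, 0 ≤ i ∧ i < C ∧ (Mmat A B C).mulVec x = t + ev i := by
  have h : (Mmat A B C).mulVec x ∈ ⋃ d ∈ Ddig C, tileTranslate d T := by
    rw [← hT.2.2.2.2.2.2]; exact ⟨x, hx, rfl⟩
  simp only [Set.mem_iUnion] at h
  obtain ⟨d, ⟨i, h0, h1, rfl⟩, t, ht, he⟩ := h
  exact ⟨t, ht, i, h0, h1, he.symm⟩

theorem tile_bw {A B C : ℤ} {T : Set (Fin 3 → ℝ)} (hT : IsABCTile A B C T) {t : Fin 3 → ℝ}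
    (ht : t ∈ T) (i : ℤ) (h0 : 0 ≤ i) (h1 : i < C) :
    ∃ x ∈ T, (Mmat A B C).mulVec x = t + ev i := by
  have h : t + ev i ∈ ⋃ d ∈ Ddig C, tileTranslate d T := by
    simp only [Set.mem_iUnion]
    exact ⟨ev i, ⟨i, h0, h1, rfl⟩, t, ht, rfl⟩
  rw [← hT.2.2.2.2.2.2] at h
  exact h

/-- the four-fold intersection belonging to `τ` -/
def Jset (A B : ℤ) (T : Set (Fin 3 → ℝ)) (τ : Equiv.Perm (Fin 4)) : Set (Fin 3 → ℝ) :=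
  {x | ∀ j, x - Lr A B (pz τ j) ∈ T}

theorem iter_bound {A B C : ℤ} {n : ℕ}
    (hn : ∀ w : Fin 3 → ℝ, ‖w‖ ≤ (1/2) * ‖((Mmat A B C)^n).mulVec w‖) (m : ℕ) :
    ∀ w : Fin 3 → ℝ, ‖w‖ ≤ (1/2)^m * ‖((Mmat A B C)^(n * m)).mulVec w‖ := by
  induction m with
  | zero => intro w; simp
  | succ m ih =>
    intro w
    refine (ih w).trans ?_
    have := hn (((Mmat A B C)^(n * m)).mulVec w)
    rw [Matrix.mulVec_mulVec, ← pow_add, show n + n * m = n * (m + 1) by ring] at this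
    calc _ ≤ (1/2:ℝ)^m * ((1/2) * ‖((Mmat A B C)^(n * (m + 1))).mulVec w‖) := by gcongr
      _ = _ := by ring

theorem le_zero_of_half {a R : ℝ} (h : ∀ m : ℕ, a ≤ (1/2)^m * R) : a ≤ 0 := by
  have : Filter.Tendsto (fun m : ℕ => (1/2:ℝ)^m * R) Filter.atTop (nhds (0 * R)) :=
    (tendsto_pow_atTop_nhds_zero_of_lt_one (by norm_num) (by norm_num)).mul_const R
  rw [zero_mul] at this
  exact ge_of_tendsto' this h

theorem approx {A B C : ℤ} {T : Set (Fin 3 → ℝ)} (hT : IsABCTile A B C T) (k : ℕ) :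
    ∀ τ, ∃ y : Fin 4 → Fin 3 → ℝ, (∀ j, y j ∈ T) ∧ ∃ τ', ∃ y' : Fin 4 → Fin 3 → ℝ,
      (∀ j, y' j ∈ T) ∧ ∀ j, ((Mmat A B C)^k).mulVec (y j + Lr A B (pz τ j) - y 0) =
        y' j + Lr A B (pz τ' j) - y' 0 := by
  induction k with
  | zero =>
    intro τ
    obtain ⟨t, ht⟩ := hT.2.2.2.1
    exact ⟨fun _ => t, fun _ => ht, τ, fun _ => t, fun _ => ht, fun j => by simp⟩
  | succ k ih =>
    intro τ
    obtain ⟨d, hd1, hd2⟩ := dig_exists A B C hT.1 hT.2.1 hT.2.2.1 τ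
    obtain ⟨y, hy, τ', y', hy', h⟩ := ih (nxt τ)
    choose x hx hxe using fun j => tile_bw hT (hy j) (d j) (hd1 j).1 (hd1 j).2
    refine ⟨x, hx, τ', y', hy', fun j => ?_⟩
    rw [← h j, pow_succ, ← Matrix.mulVec_mulVec]
    congr 1
    rw [Matrix.mulVec_sub, Matrix.mulVec_add, hxe, hxe, M_p A B C τ d hd2, ← ev_sub]
    abel

theorem J_nonempty {A B C : ℤ} {T : Set (Fin 3 → ℝ)} (hT : IsABCTile A B C T)
    (τ : Equiv.Perm (Fin 4)) : (Jset A B T τ).Nonempty := by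
  obtain ⟨n, hn⟩ := expand A B C hT.1 hT.2.1 hT.2.2.1
  have hc : IsCompact (Set.univ.pi fun _ : Fin 4 => T) :=
    isCompact_univ_pi fun _ => hT.2.2.2.2.1
  obtain ⟨t0, ht0⟩ := hT.2.2.2.1
  obtain ⟨y, hy, hmin⟩ := hc.exists_isMinOn (f := fun y : Fin 4 → Fin 3 → ℝ =>
      ‖fun j => y j + Lr A B (pz τ j) - y 0‖) ⟨fun _ => t0, fun _ _ => ht0⟩
      (by fun_prop)
  obtain ⟨R, hR⟩ := hT.2.2.2.2.1.isBounded.exists_norm_le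
  obtain ⟨R', hR'⟩ : ∃ R' : ℝ, ∀ q : Equiv.Perm (Fin 4) × Fin 4, ‖Lr A B (pz q.1 q.2)‖ ≤ R' := by
    obtain ⟨R', h⟩ := (Set.finite_range
      fun q : Equiv.Perm (Fin 4) × Fin 4 => ‖Lr A B (pz q.1 q.2)‖).bddAbove
    exact ⟨R', fun q => h ⟨q, rfl⟩⟩
  have hz : ‖fun j => y j + Lr A B (pz τ j) - y 0‖ ≤ 0 := by
    apply le_zero_of_half (R := R + R' + R)
    intro m
    obtain ⟨x, hx, τ', x', hx', h⟩ := approx hT (n * m) τ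
    refine (hmin (show x ∈ _ from fun j _ => hx j)).trans ?_
    have hb : ∀ j, ‖x' j + Lr A B (pz τ' j) - x' 0‖ ≤ R + R' + R := fun j =>
      (norm_sub_le _ _).trans (add_le_add ((norm_add_le _ _).trans
        (add_le_add (hR _ (hx' j)) (hR' (τ', j)))) (hR _ (hx' 0)))
    have hpos : 0 ≤ R + R' + R := (norm_nonneg _).trans (hb 0)
    refine (pi_norm_le_iff_of_nonneg (by positivity)).2 fun j => ?_
    refine (iter_bound hn m _).trans ?_
    rw [h j]
    gcongr
    exact hb j
  have hz' : (fun j => y j + Lr A B (pz τ j) - y 0) = 0 := norm_le_zero_iff.1 hz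
  refine ⟨y 0, fun j => ?_⟩
  have := congrFun hz' j
  have e : y 0 - Lr A B (pz τ j) = y j := by
    have h2 : y j + Lr A B (pz τ j) - y 0 = 0 := this
    rw [← sub_eq_zero, ← neg_eq_zero, ← h2]; abel
  rw [e]
  exact hy j (Set.mem_univ _)

theorem J_sub {A B : ℤ} {T : Set (Fin 3 → ℝ)} (τ : Equiv.Perm (Fin 4)) :
    Jset A B T τ = T ∩ tileTranslate (toR (Lz A B (pz τ 1))) T ∩
      tileTranslate (toR (Lz A B (pz τ 2))) T ∩ tileTranslate (toR (Lz A B (pz τ 3))) T := by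
  ext x
  simp only [Set.mem_inter_iff, mem_tr, Jset, Set.mem_ofPred_eq]
  constructor
  · intro h
    have h0 := h 0
    rw [(pz_step τ).1, Lr_zero, sub_zero] at h0
    exact ⟨⟨⟨h0, h 1⟩, h 2⟩, h 3⟩
  · rintro ⟨⟨⟨h0, h1⟩, h2⟩, h3⟩ j
    fin_cases j
    · change x - Lr A B (pz τ 0) ∈ T
      rw [(pz_step τ).1, Lr_zero, sub_zero]
      exact h0
    · exact h1
    · exact h2
    · exact h3

theorem nb_eq {A B C : ℤ} {T : Set (Fin 3 → ℝ)} (hT : IsABCTile A B C T)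
    (h14 : (Neighbors T).ncard = 14) : Neighbors T = Lz A B '' (S0 : Set (ℤ × ℤ × ℤ)) := by
  symm
  apply Set.eq_of_subset_of_ncard_le
  · rintro _ ⟨s, hs, rfl⟩
    refine ⟨fun h => S0_ne s hs (Lz_inj A B (h.trans (Lz_zero A B).symm)), ?_⟩
    obtain ⟨τ, h⟩ := S0_mem s hs
    obtain ⟨x, hx⟩ := J_nonempty hT τ
    rw [J_sub] at hx
    obtain ⟨⟨⟨h0, h1⟩, h2⟩, h3⟩ := hx
    rcases h with h | h | h <;> rw [h]
    · exact ⟨x, h0, h1⟩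
    · exact ⟨x, h0, h2⟩
    · exact ⟨x, h0, h3⟩
  · rw [h14, Set.ncard_image_of_injective _ (Lz_inj A B), Set.ncard_coe_finset, S0_card]
  · exact Set.finite_of_ncard_ne_zero (by rw [h14]; norm_num)

theorem delta_ge (A B C : ℤ) (k : Fin 4) (Δ : ℤ) (hΔ : 1 - C ≤ Δ)
    (h : (Δ - ((wz k).1 * A + (wz k).2.1 * B + (wz k).2.2 * C), (wz k).1, (wz k).2.1) ∈ S0 ∨
      (Δ - ((wz k).1 * A + (wz k).2.1 * B + (wz k).2.2 * C), (wz k).1, (wz k).2.1) = 0) :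
    cz A B C k ≤ Δ := by
  fin_cases k <;> simp [wz, S0, cz] at h ⊢ <;> lia

theorem J_step {A B C : ℤ} {T : Set (Fin 3 → ℝ)} (hT : IsABCTile A B C T)
    (hS : Neighbors T = Lz A B '' (S0 : Set (ℤ × ℤ × ℤ))) (τ : Equiv.Perm (Fin 4))
    (d : Fin 4 → ℤ) (hd : Dig A B C τ d) (x : Fin 3 → ℝ) (hx : x ∈ Jset A B T τ) :
    (Mmat A B C).mulVec x - ev (d 0) ∈ Jset A B T (nxt τ) := by
  choose t ht i hi0 hi1 hi using fun j => tile_fw hT (hx j)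
  simp only [Matrix.mulVec_sub] at hi
  have hge : ∀ j, cz A B C (τ j) ≤ i (j + 1) - i j := by
    intro j
    apply delta_ge A B C (τ j)
    · have := hi0 (j + 1); have := hi1 j; lia
    set s : ℤ × ℤ × ℤ := (i (j + 1) - i j - ((wz (τ j)).1 * A + (wz (τ j)).2.1 * B +
      (wz (τ j)).2.2 * C), (wz (τ j)).1, (wz (τ j)).2.1) with hs
    by_cases h0 : s = 0
    · exact Or.inr h0
    left
    have e : t j - Lr A B s = t (j + 1) := by
      have e1 := hi j
      have e2 := hi (j + 1)
      rw [pz_succ, Lr_add, Matrix.mulVec_add, 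
        show wz (τ j) = ((wz (τ j)).1, (wz (τ j)).2.1, (wz (τ j)).2.2) from rfl,
        M_Lr A B C (wz (τ j)).1] at e2
      have e3 : Lr A B s = Lr A B (-((wz (τ j)).1 * A + (wz (τ j)).2.1 * B +
          (wz (τ j)).2.2 * C), (wz (τ j)).1, (wz (τ j)).2.1) + (ev (i (j + 1)) - ev (i j)) := by
        rw [ev_sub, Lr_ev, hs]; congr 2; ring
      rw [e3]
      have e1' := eq_sub_of_add_eq e1.symm
      have e2' := eq_sub_of_add_eq e2.symm
      rw [e1', e2']; abel
    have : Lz A B s ∈ Neighbors T := by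
      refine ⟨fun h => h0 (Lz_inj A B (h.trans (Lz_zero A B).symm)), t j, ht j, ?_⟩
      rw [mem_tr]
      change t j - Lr A B s ∈ T
      rw [e]; exact ht _
    rw [hS] at this
    obtain ⟨s', hs', he⟩ := this
    rw [← Lz_inj A B he]; exact hs'
  have hsum := cz_sum A B C τ
  have heq : ∀ j, i (j + 1) - i j = cz A B C (τ j) := by
    have g0 : cz A B C (τ 0) ≤ i 1 - i 0 := hge 0
    have g1 : cz A B C (τ 1) ≤ i 2 - i 1 := hge 1
    have g2 : cz A B C (τ 2) ≤ i 3 - i 2 := hge 2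
    have g3 : cz A B C (τ 3) ≤ i 0 - i 3 := hge 3
    intro j
    fin_cases j
    · change i 1 - i 0 = cz A B C (τ 0); lia
    · change i 2 - i 1 = cz A B C (τ 1); lia
    · change i 3 - i 2 = cz A B C (τ 2); lia
    · change i 0 - i 3 = cz A B C (τ 3); lia
  have h0 := dig_unique A B C τ d i hd ⟨fun j => ⟨hi0 j, hi1 j⟩, heq⟩
  intro j
  have e1 := hi j
  rw [M_p A B C τ i heq, ← ev_sub] at e1
  have : (Mmat A B C).mulVec x - ev (d 0) - Lr A B (pz (nxt τ) j) = t j := by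
    rw [h0, eq_sub_of_add_eq e1.symm]; abel
  rw [this]; exact ht j

theorem J_subsingleton {A B C : ℤ} {T : Set (Fin 3 → ℝ)} (hT : IsABCTile A B C T)
    (hS : Neighbors T = Lz A B '' (S0 : Set (ℤ × ℤ × ℤ))) (τ : Equiv.Perm (Fin 4)) :
    (Jset A B T τ).Subsingleton := by
  intro x hx x' hx'
  obtain ⟨n, hn⟩ := expand A B C hT.1 hT.2.1 hT.2.2.1
  obtain ⟨R, hR⟩ := hT.2.2.2.2.1.isBounded.exists_norm_le
  have it : ∀ k : ℕ, ∀ τ, ∀ x ∈ Jset A B T τ, ∀ x' ∈ Jset A B T τ, ∃ y ∈ T, ∃ y' ∈ T,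
      ((Mmat A B C)^k).mulVec (x - x') = y - y' := by
    intro k
    induction k with
    | zero =>
      intro τ x hx x' hx'
      have a := hx 0
      have b := hx' 0
      rw [(pz_step τ).1, Lr_zero, sub_zero] at a b
      exact ⟨x, a, x', b, by simp⟩
    | succ k ih =>
      intro τ x hx x' hx'
      obtain ⟨d, hd⟩ := dig_exists A B C hT.1 hT.2.1 hT.2.2.1 τ
      obtain ⟨y, hy, y', hy', h⟩ := ih _ _ (J_step hT hS τ d hd x hx) _ (J_step hT hS τ d hd x' hx')
      refine ⟨y, hy, y', hy', ?_⟩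
      rw [← h, pow_succ, ← Matrix.mulVec_mulVec, Matrix.mulVec_sub (Mmat A B C)]
      congr 1; abel
  rw [← sub_eq_zero, ← norm_le_zero_iff]
  apply le_zero_of_half (R := R + R)
  intro m
  refine (iter_bound hn m _).trans ?_
  obtain ⟨y, hy, y', hy', h⟩ := it (n * m) τ x hx x' hx'
  rw [h]
  gcongr
  exact (norm_sub_le _ _).trans (add_le_add (hR _ hy) (hR _ hy'))

theorem inter_set (T : Set (Fin 3 → ℝ)) (α β γ : Fin 3 → ℤ) :
    T ∩ tileTranslate (toR α) T ∩ tileTranslate (toR β) T ∩ tileTranslate (toR γ) T =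
    {x | x ∈ T ∧ ∀ δ ∈ ({α, β, γ} : Set (Fin 3 → ℤ)), x ∈ tileTranslate (toR δ) T} := by
  ext x
  constructor
  · rintro ⟨⟨⟨h0, h1⟩, h2⟩, h3⟩
    refine ⟨h0, ?_⟩
    rintro δ (rfl | rfl | rfl)
    · exact h1
    · exact h2
    · exact h3
  · rintro ⟨h0, h⟩
    exact ⟨⟨⟨h0, h _ (by simp)⟩, h _ (by simp)⟩, h _ (by simp)⟩

theorem nb_of_inter (T : Set (Fin 3 → ℝ)) (x : Fin 3 → ℝ) (α β : Fin 3 → ℤ) (h : α ≠ β)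
    (ha : x ∈ tileTranslate (toR α) T) (hb : x ∈ tileTranslate (toR β) T) :
    α - β ∈ Neighbors T := by
  refine ⟨sub_ne_zero.2 h, x - toR β, (mem_tr _ _ _).1 hb, ?_⟩
  rw [mem_tr, toR_sub] at *
  simpa using ha

theorem classify' {A B : ℤ} {T : Set (Fin 3 → ℝ)}
    (hS : Neighbors T = Lz A B '' (S0 : Set (ℤ × ℤ × ℤ))) (α β γ : Fin 3 → ℤ)
    (ha : α ≠ 0) (hb : β ≠ 0) (hc : γ ≠ 0) (hab : α ≠ β) (hac : α ≠ γ) (hbc : β ≠ γ)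
    (hne : (T ∩ tileTranslate (toR α) T ∩ tileTranslate (toR β) T ∩
      tileTranslate (toR γ) T).Nonempty) :
    ∃ f ∈ F0, ({α, β, γ} : Set (Fin 3 → ℤ)) = Lz A B '' (f : Set (ℤ × ℤ × ℤ)) := by
  obtain ⟨x, ⟨⟨h0, h1⟩, h2⟩, h3⟩ := hne
  have na : α ∈ Neighbors T := ⟨ha, x, h0, h1⟩
  have nb : β ∈ Neighbors T := ⟨hb, x, h0, h2⟩
  have nc : γ ∈ Neighbors T := ⟨hc, x, h0, h3⟩
  have nab := nb_of_inter T x α β hab h1 h2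
  have nac := nb_of_inter T x α γ hac h1 h3
  have nbc := nb_of_inter T x β γ hbc h2 h3
  rw [hS] at na nb nc nab nac nbc
  obtain ⟨a, ma, rfl⟩ := na
  obtain ⟨b, mb, rfl⟩ := nb
  obtain ⟨c, mc, rfl⟩ := nc
  rw [← Lz_sub, (Lz_inj A B).mem_set_image] at nab nac nbc
  refine ⟨{a, b, c}, (((((classify a ma b mb).resolve_left
    (not_not.2 nab)) c mc).resolve_left (not_not.2 nac)).resolve_left (not_not.2 nbc)), ?_⟩
  simp [Set.image_insert_eq]

theorem F0_set {A B : ℤ} {f : Finset (ℤ × ℤ × ℤ)} (hf : f ∈ F0) :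
    ∃ τ, Lz A B '' (f : Set (ℤ × ℤ × ℤ)) = 
      {Lz A B (pz τ 1), Lz A B (pz τ 2), Lz A B (pz τ 3)} := by
  obtain ⟨τ, -, rfl⟩ := Finset.mem_image.1 hf
  exact ⟨τ, by simp [Set.image_insert_eq]⟩

theorem stmt7 (A B C : ℤ) (T : Set (Fin 3 → ℝ)) (hT : IsABCTile A B C T)
    (h14 : (Neighbors T).ncard = 14) :
    (∀ α β γ : Fin 3 → ℤ, α ≠ 0 → β ≠ 0 → γ ≠ 0 → α ≠ β → α ≠ γ → β ≠ γ →
      T ∩ tileTranslate (toR α) T ∩ tileTranslate (toR β) T ∩ tileTranslate (toR γ) T = ∅ ∨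
      (∃ x : Fin 3 → ℝ,
        T ∩ tileTranslate (toR α) T ∩ tileTranslate (toR β) T ∩ tileTranslate (toR γ) T = {x})) ∧
    {s : Set (Fin 3 → ℤ) | ∃ α β γ : Fin 3 → ℤ, α ≠ 0 ∧ β ≠ 0 ∧ γ ≠ 0 ∧
      α ≠ β ∧ α ≠ γ ∧ β ≠ γ ∧ s = {α, β, γ} ∧
      (T ∩ tileTranslate (toR α) T ∩ tileTranslate (toR β) T ∩ tileTranslate (toR γ) T).Nonempty}.ncard
      = 24 := by
  have hS := nb_eq hT h14
  refine ⟨?_, ?_⟩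
  · intro α β γ ha hb hc hab hac hbc
    rcases Set.eq_empty_or_nonempty (T ∩ tileTranslate (toR α) T ∩ tileTranslate (toR β) T ∩
      tileTranslate (toR γ) T) with h | h
    · exact Or.inl h
    right
    obtain ⟨f, hf, he⟩ := classify' hS α β γ ha hb hc hab hac hbc h
    obtain ⟨τ, hτ⟩ := F0_set (A := A) (B := B) hf
    obtain ⟨x, hx⟩ := J_nonempty hT τ
    refine ⟨x, ?_⟩
    rw [inter_set, he, hτ, ← inter_set, ← J_sub]
    exact (J_subsingleton hT hS τ).eq_singleton_of_mem hx
  · have hset : {s : Set (Fin 3 → ℤ) | ∃ α β γ : Fin 3 → ℤ, α ≠ 0 ∧ β ≠ 0 ∧ γ ≠ 0 ∧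
        α ≠ β ∧ α ≠ γ ∧ β ≠ γ ∧ s = {α, β, γ} ∧
        (T ∩ tileTranslate (toR α) T ∩ tileTranslate (toR β) T ∩
          tileTranslate (toR γ) T).Nonempty} =
        (fun f : Finset (ℤ × ℤ × ℤ) => Lz A B '' (f : Set (ℤ × ℤ × ℤ))) ''
          (F0 : Set (Finset (ℤ × ℤ × ℤ))) := by
      ext s
      constructor
      · rintro ⟨α, β, γ, ha, hb, hc, hab, hac, hbc, rfl, h⟩
        obtain ⟨f, hf, he⟩ := classify' hS α β γ ha hb hc hab hac hbc h
        exact ⟨f, hf, he.symm⟩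
      · rintro ⟨f, hf, rfl⟩
        obtain ⟨τ, hτ⟩ := F0_set (A := A) (B := B) hf
        obtain ⟨p1, p2, p3, p4, p5, p6⟩ := pz_ne τ
        have inj := Lz_inj A B
        have nz : ∀ s, s ≠ 0 → Lz A B s ≠ 0 := fun s hs h =>
          hs (inj (h.trans (Lz_zero A B).symm))
        refine ⟨_, _, _, nz _ p1, nz _ p2, nz _ p3, inj.ne p4, inj.ne p5, inj.ne p6, hτ, ?_⟩
        rw [← J_sub]
        exact J_nonempty hT τ
    rw [hset, Set.ncard_image_of_injective, Set.ncard_coe_finset, F0_card]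
    intro f g h
    exact Finset.coe_injective ((Lz_inj A B).image_injective h)
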